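/- arXiv:1503.08559 — 2 statements merged into one kernel-verified Lean document; each statement's English description precedes it below -/
import Mathlib

section
/- Let p ≥ 2 be an integer and define Ω : [0,∞)² → [0,∞) by Ω(a,b) := (5p/2) √2 (2 a^{3/2} b^{1/2})^{(p−1)/2} a^{1/4} b^{3/4} + 2 p(p−1) (2 a^{3/2} b^{1/2})^{(p−2)/2} a b. Then Ω is nondecreasing in each argument, and for every Schwartz function u : ℝ → ℝ, − ∫_ℝ u^p u' u'''' dx ≤ Ω(‖u‖_{L²}, ‖u''‖_{L²}) · ‖u''‖²_{L²}. -/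
open MeasureTheory

/-- `Ω(a,b) = (5p/2)√2 (2a^{3/2}b^{1/2})^{(p-1)/2} a^{1/4} b^{3/4}
  + 2p(p-1) (2a^{3/2}b^{1/2})^{(p-2)/2} a b`. -/
noncomputable def Omega (p : ℕ) (a b : ℝ) : ℝ :=
  (5 * (p : ℝ) / 2) * Real.sqrt 2 *
      (2 * a ^ (3 / 2 : ℝ) * b ^ (1 / 2 : ℝ)) ^ (((p : ℝ) - 1) / 2) *
      a ^ (1 / 4 : ℝ) * b ^ (3 / 4 : ℝ)
    + 2 * (p : ℝ) * ((p : ℝ) - 1) *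
        (2 * a ^ (3 / 2 : ℝ) * b ^ (1 / 2 : ℝ)) ^ (((p : ℝ) - 2) / 2) * a * b

theorem MeasureTheory.Integrable.mul_schwartzMap_pow {F : ℝ → ℝ} (hF : Integrable F)
    (f : SchwartzMap ℝ ℝ) (n : ℕ) : Integrable (fun x => F x * f x ^ n) := by
  refine hF.mul_bdd (c := (SchwartzMap.seminorm ℝ 0 0 f) ^ n)
    (f.continuous.pow n).aestronglyMeasurable (ae_of_all _ fun x => ?_)
  rw [norm_pow]
  exact pow_le_pow_left₀ (norm_nonneg _) (SchwartzMap.norm_le_seminorm ℝ f x) n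

theorem MeasureTheory.Integrable.mul_schwartzMap {F : ℝ → ℝ} (hF : Integrable F)
    (f : SchwartzMap ℝ ℝ) : Integrable (fun x => F x * f x) := by
  simpa using hF.mul_schwartzMap_pow f 1

/-- Cauchy–Schwarz inequality for Schwartz functions. -/
theorem SchwartzMap.integral_abs_mul_abs_le (f g : SchwartzMap ℝ ℝ) :
    ∫ x, |f x| * |g x| ≤ √(∫ x, f x ^ 2) * √(∫ x, g x ^ 2) := by
  have h := integral_mul_norm_le_Lp_mul_Lq (μ := volume) Real.HolderConjugate.two_two
    (f.memLp _ _) (g.memLp _ _)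
  simpa [Real.sqrt_eq_rpow] using h

/-- One-dimensional Agmon inequality: the square of the sup norm is at most twice the product of
the L² norms of the function and of its derivative. -/
theorem SchwartzMap.sq_le_two_mul_sqrt_mul_sqrt (f f' : SchwartzMap ℝ ℝ)
    (hf : ∀ x, HasDerivAt f (f' x) x) (x : ℝ) :
    f x ^ 2 ≤ 2 * (√(∫ x, f x ^ 2) * √(∫ x, f' x ^ 2)) := by
  have hint : Integrable (fun x => 2 * (f x * f' x)) :=
    (f.integrable.mul_schwartzMap f').const_mul 2
  have hint_abs : Integrable (fun x => 2 * (|f x| * |f' x|)) := by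
    simpa [abs_mul] using hint.norm
  have hderiv (y : ℝ) : HasDerivAt (fun x => f x ^ 2) (2 * (f y * f' y)) y := by
    refine ((hf y).pow 2).congr_deriv ?_
    push_cast
    ring
  have hlim : Filter.Tendsto (fun x => f x ^ 2) Filter.atBot (nhds 0) := by
    simpa using (f.tendsto_cocompact.mono_left atBot_le_cocompact).pow 2
  calc f x ^ 2 = ∫ y in Set.Iic x, 2 * (f y * f' y) := by
        rw [integral_Iic_of_hasDerivAt_of_tendsto' (fun y _ => hderiv y) hint.integrableOn hlim,
          sub_zero]
    _ ≤ ∫ y in Set.Iic x, 2 * (|f y| * |f' y|) := by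
        refine integral_mono hint.integrableOn hint_abs.integrableOn fun y => ?_
        simpa [abs_mul] using le_abs_self (f y * f' y)
    _ ≤ ∫ y, 2 * (|f y| * |f' y|) :=
        setIntegral_le_integral hint_abs (ae_of_all _ fun y => by positivity)
    _ ≤ 2 * (√(∫ x, f x ^ 2) * √(∫ x, f' x ^ 2)) := by
        rw [integral_const_mul]
        exact mul_le_mul_of_nonneg_left (f.integral_abs_mul_abs_le f') zero_le_two

/-- Interpolation of the L² norm of the first derivative between orders zero and two. -/
theorem SchwartzMap.integral_deriv_sq_le (f f' f'' : SchwartzMap ℝ ℝ)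
    (hf : ∀ x, HasDerivAt f (f' x) x) (hf' : ∀ x, HasDerivAt f' (f'' x) x) :
    ∫ x, f' x ^ 2 ≤ √(∫ x, f x ^ 2) * √(∫ x, f'' x ^ 2) := by
  have hsq : Integrable (fun x => f' x ^ 2) := by
    simpa [sq] using f'.integrable.mul_schwartzMap f'
  have hmul := f.integrable.mul_schwartzMap f''
  have hzero : ∫ x, (f' x ^ 2 + f x * f'' x) = 0 := by
    refine integral_eq_zero_of_hasDerivAt_of_integrable (f := fun x => f x * f' x)
      (fun x => ?_) (hsq.add hmul) (f.integrable.mul_schwartzMap f')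
    refine ((hf x).mul (hf' x)).congr_deriv ?_
    ring
  rw [integral_add hsq hmul] at hzero
  calc ∫ x, f' x ^ 2 = -∫ x, f x * f'' x := by linarith
    _ ≤ |∫ x, f x * f'' x| := neg_le_abs _
    _ ≤ ∫ x, |f x * f'' x| := abs_integral_le_integral_abs
    _ ≤ _ := by simpa only [abs_mul] using f.integral_abs_mul_abs_le f''

/-- Integration by parts eliminating the derivatives of order three and four. -/
theorem SchwartzMap.neg_integral_pow_mul_deriv_mul_fourth_deriv (q : ℕ)
    (u v w z y : SchwartzMap ℝ ℝ) (hu : ∀ x, HasDerivAt u (v x) x)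
    (hv : ∀ x, HasDerivAt v (w x) x) (hw : ∀ x, HasDerivAt w (z x) x)
    (hz : ∀ x, HasDerivAt z (y x) x) :
    -(∫ x, u x ^ (q + 2) * v x * y x) =
      ∫ x, -(((q : ℝ) + 2) * (q + 1) * (u x ^ q * v x ^ 3 * w x) +
        5 * ((q : ℝ) + 2) / 2 * (u x ^ (q + 1) * v x * w x ^ 2)) := by
  have h₁ : Integrable (fun x => u x ^ (q + 2) * v x * y x) := by
    convert (v.integrable.mul_schwartzMap y).mul_schwartzMap_pow u (q + 2) using 2
    ring
  have h₂ : Integrable (fun x => u x ^ q * v x ^ 3 * w x) := by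
    convert (w.integrable.mul_schwartzMap_pow v 3).mul_schwartzMap_pow u q using 2
    ring
  have h₃ : Integrable (fun x => u x ^ (q + 1) * v x * w x ^ 2) := by
    convert (v.integrable.mul_schwartzMap_pow w 2).mul_schwartzMap_pow u (q + 1) using 2
    ring
  have h₄ : Integrable (fun x => ((q : ℝ) + 2) * (q + 1) * (u x ^ q * v x ^ 3 * w x) +
      5 * ((q : ℝ) + 2) / 2 * (u x ^ (q + 1) * v x * w x ^ 2)) :=
    (h₂.const_mul _).add (h₃.const_mul _)
  have hprim : Integrable (fun x => u x ^ (q + 2) * v x * z x -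
      ((q : ℝ) + 2) * (u x ^ (q + 1) * v x ^ 2 * w x) - 1 / 2 * (u x ^ (q + 2) * w x ^ 2)) := by
    refine (Integrable.sub ?_ (Integrable.const_mul ?_ _)).sub (Integrable.const_mul ?_ _)
    · convert (v.integrable.mul_schwartzMap z).mul_schwartzMap_pow u (q + 2) using 2
      ring
    · convert (w.integrable.mul_schwartzMap_pow v 2).mul_schwartzMap_pow u (q + 1) using 2
      ring
    · convert (w.integrable.mul_schwartzMap w).mul_schwartzMap_pow u (q + 2) using 2
      ring
  have hzero := integral_eq_zero_of_hasDerivAt_of_integrable (fun x => by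
    refine HasDerivAt.congr_deriv (g' := u x ^ (q + 2) * v x * y x -
      (((q : ℝ) + 2) * (q + 1) * (u x ^ q * v x ^ 3 * w x) +
        5 * ((q : ℝ) + 2) / 2 * (u x ^ (q + 1) * v x * w x ^ 2)))
      ((((((hu x).pow (q + 2)).mul (hv x)).mul (hz x)).sub
      (((((hu x).pow (q + 1)).mul ((hv x).pow 2)).mul (hw x)).const_mul ((q : ℝ) + 2))).sub
      ((((hu x).pow (q + 2)).mul ((hw x).pow 2)).const_mul (1 / 2))) ?_
    simp only [Pi.pow_apply, Pi.mul_apply, Nat.add_sub_cancel, Nat.reduceSub,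
      show q + 2 - 1 = q + 1 from rfl]
    push_cast
    ring) (h₁.sub h₄) hprim
  rw [integral_sub' h₁ h₄] at hzero
  rw [integral_neg]
  linarith

theorem abs_pow_le_rpow_of_sq_le {t M : ℝ} (h : t ^ 2 ≤ M) (k : ℕ) :
    |t| ^ k ≤ M ^ ((k : ℝ) / 2) := by
  calc |t| ^ k ≤ √M ^ k := pow_le_pow_left₀ (abs_nonneg t) (Real.abs_le_sqrt h) k
    _ = M ^ ((k : ℝ) / 2) := by
      rw [Real.sqrt_eq_rpow, ← Real.rpow_natCast, ← Real.rpow_mul ((sq_nonneg t).trans h)]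
      congr 1
      ring

theorem Omega_le_Omega {p : ℕ} (hp : 2 ≤ p) {a a' b b' : ℝ} (ha : 0 ≤ a) (haa' : a ≤ a')
    (hb : 0 ≤ b) (hbb' : b ≤ b') : Omega p a b ≤ Omega p a' b' := by
  have hp' : (2 : ℝ) ≤ p := by exact_mod_cast hp
  have h₁ : (0 : ℝ) ≤ (p : ℝ) - 1 := by linarith
  have h₂ : (0 : ℝ) ≤ (p : ℝ) - 2 := by linarith
  have ha' := ha.trans haa'
  have hb' := hb.trans hbb'
  unfold Omega
  gcongr

theorem Omega_pow_four {q : ℕ} {s t : ℝ} (hs : 0 ≤ s) (ht : 0 ≤ t) :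
    Omega (q + 2) (s ^ 4) (t ^ 4) =
      5 * ((q : ℝ) + 2) / 2 * √2 * (2 * s ^ 6 * t ^ 2) ^ (((q + 1 : ℕ) : ℝ) / 2) * s * t ^ 3 +
        2 * ((q : ℝ) + 2) * (q + 1) * (2 * s ^ 6 * t ^ 2) ^ ((q : ℝ) / 2) * s ^ 4 * t ^ 4 := by
  have key {r : ℝ} (hr : 0 ≤ r) (e : ℝ) (n : ℕ) (h : 4 * e = n) : (r ^ 4) ^ e = r ^ n := by
    rw [← Real.rpow_natCast, ← Real.rpow_mul hr, ← Real.rpow_natCast, ← h]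
    norm_num
  unfold Omega
  rw [key hs (3 / 2) 6 (by norm_num), key hs (1 / 4) 1 (by norm_num),
    key ht (1 / 2) 2 (by norm_num), key ht (3 / 4) 3 (by norm_num)]
  push_cast
  rw [show (q : ℝ) + 2 - 1 = q + 1 by ring, show (q : ℝ) + 2 - 2 = q by ring, pow_one]

theorem SchwartzMap.neg_integral_pow_mul_deriv_mul_fourth_deriv_le (q : ℕ)
    (u v w z y : SchwartzMap ℝ ℝ) (hu : ∀ x, HasDerivAt u (v x) x)
    (hv : ∀ x, HasDerivAt v (w x) x) (hw : ∀ x, HasDerivAt w (z x) x)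
    (hz : ∀ x, HasDerivAt z (y x) x) :
    -(∫ x, u x ^ (q + 2) * v x * y x) ≤
      Omega (q + 2) √(∫ x, u x ^ 2) √(∫ x, w x ^ 2) * ∫ x, w x ^ 2 := by
  have hroot {a : ℝ} (ha : 0 ≤ a) : ∃ s, 0 ≤ s ∧ a = s ^ 4 :=
    ⟨√(√a), by positivity, by
      rw [show √(√a) ^ 4 = (√(√a) ^ 2) ^ 2 by ring, Real.sq_sqrt (by positivity),
        Real.sq_sqrt ha]⟩
  obtain ⟨s, hs, has⟩ := hroot (Real.sqrt_nonneg (∫ x, u x ^ 2))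
  obtain ⟨t, ht, hbt⟩ := hroot (Real.sqrt_nonneg (∫ x, w x ^ 2))
  have hw2 : ∫ x, w x ^ 2 = t ^ 8 := by
    rw [← Real.sq_sqrt (integral_nonneg fun x => sq_nonneg (w x)), hbt]
    ring
  have hc : √(∫ x, v x ^ 2) ≤ s ^ 2 * t ^ 2 := by
    refine Real.sqrt_le_iff.2 ⟨by positivity, ?_⟩
    have := u.integral_deriv_sq_le v w hu hv
    rw [has, hbt] at this
    linarith
  have hubound (x : ℝ) : u x ^ 2 ≤ 2 * s ^ 6 * t ^ 2 := by
    have := u.sq_le_two_mul_sqrt_mul_sqrt v hu x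
    rw [has] at this
    calc u x ^ 2 ≤ _ := this
      _ ≤ 2 * (s ^ 4 * (s ^ 2 * t ^ 2)) := by gcongr
      _ = _ := by ring
  have hvbound (x : ℝ) : v x ^ 2 ≤ 2 * s ^ 2 * t ^ 6 := by
    have := v.sq_le_two_mul_sqrt_mul_sqrt w hv x
    rw [hbt] at this
    calc v x ^ 2 ≤ _ := this
      _ ≤ 2 * ((s ^ 2 * t ^ 2) * t ^ 4) := by gcongr
      _ = _ := by ring
  have hvabs (x : ℝ) : |v x| ≤ √2 * s * t ^ 3 := by
    refine abs_le_of_sq_le_sq ?_ (by positivity)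
    rw [mul_pow, mul_pow, Real.sq_sqrt zero_le_two]
    linarith [hvbound x]
  have hvw : ∫ x, |v x| * |w x| ≤ s ^ 2 * t ^ 6 := by
    have := v.integral_abs_mul_abs_le w
    rw [hbt] at this
    calc _ ≤ _ := this
      _ ≤ (s ^ 2 * t ^ 2) * t ^ 4 := by gcongr
      _ = _ := by ring
  set A : ℝ := (2 * s ^ 6 * t ^ 2) ^ (((q + 1 : ℕ) : ℝ) / 2) with hA
  set B : ℝ := (2 * s ^ 6 * t ^ 2) ^ ((q : ℝ) / 2) with hB
  have hA0 : 0 ≤ A := by positivity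
  have hB0 : 0 ≤ B := by positivity
  have hvw_int : Integrable (fun x => |v x| * |w x|) := by
    simpa [abs_mul] using (v.integrable.mul_schwartzMap w).abs
  have hww_int : Integrable (fun x => w x ^ 2) := by
    simpa [sq] using w.integrable.mul_schwartzMap w
  have hmaj := (hvw_int.const_mul (((q : ℝ) + 2) * (q + 1) * (B * (2 * s ^ 2 * t ^ 6)))).add
    (hww_int.const_mul (5 * ((q : ℝ) + 2) / 2 * (A * (√2 * s * t ^ 3))))
  have hint₁ : Integrable (fun x => u x ^ q * v x ^ 3 * w x) := by
    convert (w.integrable.mul_schwartzMap_pow v 3).mul_schwartzMap_pow u q using 2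
    ring
  have hint₂ : Integrable (fun x => u x ^ (q + 1) * v x * w x ^ 2) := by
    convert (v.integrable.mul_schwartzMap_pow w 2).mul_schwartzMap_pow u (q + 1) using 2
    ring
  rw [neg_integral_pow_mul_deriv_mul_fourth_deriv q u v w z y hu hv hw hz, has, hbt,
    Omega_pow_four hs ht, ← hA, ← hB]
  calc _ ≤ ∫ x, (((q : ℝ) + 2) * (q + 1) * (B * (2 * s ^ 2 * t ^ 6)) * (|v x| * |w x|) +
          5 * ((q : ℝ) + 2) / 2 * (A * (√2 * s * t ^ 3)) * w x ^ 2) := by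
        refine integral_mono ((hint₁.const_mul _).add (hint₂.const_mul _)).neg hmaj fun x => ?_
        have h₁ : -(u x ^ q * v x ^ 3 * w x) ≤ B * (2 * s ^ 2 * t ^ 6) * (|v x| * |w x|) :=
          calc _ ≤ |u x ^ q * v x ^ 3 * w x| := neg_le_abs _
            _ = |u x| ^ q * v x ^ 2 * (|v x| * |w x|) := by
              rw [abs_mul, abs_mul, abs_pow, abs_pow, ← sq_abs (v x)]
              ring
            _ ≤ _ := by
              gcongr
              · exact abs_pow_le_rpow_of_sq_le (hubound x) q
              · exact hvbound x
        have h₂ : -(u x ^ (q + 1) * v x * w x ^ 2) ≤ A * (√2 * s * t ^ 3) * w x ^ 2 :=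
          calc _ ≤ |u x ^ (q + 1) * v x * w x ^ 2| := neg_le_abs _
            _ = |u x| ^ (q + 1) * |v x| * w x ^ 2 := by
              rw [abs_mul, abs_mul, abs_pow, abs_pow (w x), sq_abs]
            _ ≤ _ := by
              gcongr
              · exact abs_pow_le_rpow_of_sq_le (hubound x) (q + 1)
              · exact hvabs x
        have h₃ := mul_le_mul_of_nonneg_left h₁
          (show (0 : ℝ) ≤ ((q : ℝ) + 2) * (q + 1) by positivity)
        have h₄ := mul_le_mul_of_nonneg_left h₂
          (show (0 : ℝ) ≤ 5 * ((q : ℝ) + 2) / 2 by positivity)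
        dsimp only
        linarith
    _ = ((q : ℝ) + 2) * (q + 1) * (B * (2 * s ^ 2 * t ^ 6)) * (∫ x, |v x| * |w x|) +
          5 * ((q : ℝ) + 2) / 2 * (A * (√2 * s * t ^ 3)) * ∫ x, w x ^ 2 := by
        rw [integral_add (hvw_int.const_mul _) (hww_int.const_mul _), integral_const_mul,
          integral_const_mul]
    _ ≤ ((q : ℝ) + 2) * (q + 1) * (B * (2 * s ^ 2 * t ^ 6)) * (s ^ 2 * t ^ 6) +
          5 * ((q : ℝ) + 2) / 2 * (A * (√2 * s * t ^ 3)) * ∫ x, w x ^ 2 := by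
        gcongr
    _ = _ := by
        rw [hw2]
        ring

/-- `Ω` is nondecreasing in each argument on `[0,∞)`, and for every real Schwartz function `u`,
`-∫ uᵖ u' u'''' ≤ Ω(‖u‖_{L²}, ‖u''‖_{L²}) ‖u''‖_{L²}²`. -/
theorem stmt_15 (p : ℕ) (hp : 2 ≤ p) :
    (∀ a a' b : ℝ, 0 ≤ a → a ≤ a' → 0 ≤ b → Omega p a b ≤ Omega p a' b) ∧
    (∀ a b b' : ℝ, 0 ≤ a → 0 ≤ b → b ≤ b' → Omega p a b ≤ Omega p a b') ∧
    ∀ u : SchwartzMap ℝ ℝ,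
      -(∫ x : ℝ, (u x) ^ p * deriv (⇑u) x * iteratedDeriv 4 (⇑u) x)
        ≤ Omega p (Real.sqrt (∫ x : ℝ, (u x) ^ 2))
            (Real.sqrt (∫ x : ℝ, (iteratedDeriv 2 (⇑u) x) ^ 2)) *
          ∫ x : ℝ, (iteratedDeriv 2 (⇑u) x) ^ 2 := by
  refine ⟨fun a a' b ha haa' hb => Omega_le_Omega hp ha haa' hb le_rfl,
    fun a b b' ha hb hbb' => Omega_le_Omega hp ha le_rfl hb hbb', fun u => ?_⟩
  obtain ⟨q, rfl⟩ := Nat.exists_eq_add_of_le' hp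
  let D := SchwartzMap.derivCLM ℝ ℝ
  have h₂ : iteratedDeriv 2 u = D (D u) := by
    rw [iteratedDeriv_succ, iteratedDeriv_one]
    rfl
  have h₄ : iteratedDeriv 4 u = D (D (D (D u))) := by
    rw [iteratedDeriv_succ, iteratedDeriv_succ, h₂]
    rfl
  rw [h₂, h₄]
  exact SchwartzMap.neg_integral_pow_mul_deriv_mul_fourth_deriv_le q u (D u) (D (D u))
    (D (D (D u))) (D (D (D (D u)))) u.hasDerivAt (D u).hasDerivAt (D (D u)).hasDerivAt
    (D (D (D u))).hasDerivAt
end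

section
/- Let p ≥ 4 be an integer and let γ : ℝ → ℝ be measurable, nonnegative, and polynomially bounded. Let u be a smooth solution of the damped generalized KdV equation ∂_t u + ∂_x u + ∂_x³ u + uᵖ ∂_x u + L_γ(u) = 0 on [0,T) × ℝ with u(0,·) = u₀. Set θ := Ω(‖u₀‖_{L²}, ‖∂_x² u₀‖_{L²}), where Ω(a,b) := (5p/2) √2 (2 a^{3/2} b^{1/2})^{(p−1)/2} a^{1/4} b^{3/4} + 2 p(p−1) (2 a^{3/2} b^{1/2})^{(p−2)/2} a b. If γ(ξ) ≥ θ for all ξ ∈ ℝ, then ‖∂_x² u(t,·)‖_{L²(ℝ)} ≤ ‖∂_x² u₀‖_{L²(ℝ)} for all t ∈ [0,T); i.e., a damping bounded below by the threshold θ prevents growth of the L²-norm of u_{xx}, and hence blow-up. -/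
open MeasureTheory

/-- Fourier transform with the convention `û(ξ) = ∫ u(x) e^{-iξx} dx`. -/
noncomputable def FTc (f : ℝ → ℂ) (ξ : ℝ) : ℂ :=
  ∫ x : ℝ, f x * Complex.exp (-(Complex.I * (ξ : ℂ) * (x : ℂ)))

/-- Fourier transform of a real-valued function. -/
noncomputable def FTr (f : ℝ → ℝ) (ξ : ℝ) : ℂ :=
  FTc (fun x => (f x : ℂ)) ξ

/-- The damping operator `L_γ(f)(x) = (1/(2π)) ∫ γ(ξ) f̂(ξ) e^{iξx} dξ` (for a real-valued
function `f` the integral is real, and we take the real part). -/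
noncomputable def Ldamp (γ : ℝ → ℝ) (f : ℝ → ℝ) (x : ℝ) : ℝ :=
  (1 / (2 * Real.pi)) *
    (∫ ξ : ℝ, (γ ξ : ℂ) * FTr f ξ * Complex.exp (Complex.I * (ξ : ℂ) * (x : ℂ))).re

/-- A real function is Schwartz: smooth with all seminorms `sup |x|^k |f^{(n)}(x)|` finite. -/
def IsSchwartzFn (f : ℝ → ℝ) : Prop :=
  ContDiff ℝ (⊤ : ℕ∞) f ∧ ∀ k n : ℕ, ∃ C : ℝ, ∀ x : ℝ, |x| ^ k * |iteratedDeriv n f x| ≤ C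

/-- `γ` is polynomially bounded. -/
def PolyBounded (γ : ℝ → ℝ) : Prop :=
  ∃ (C : ℝ) (n : ℕ), ∀ ξ : ℝ, |γ ξ| ≤ C * (1 + |ξ|) ^ n

/-- A smooth solution of the damped generalized KdV equation
`∂ₜu + ∂ₓu + ∂ₓ³u + uᵖ ∂ₓu + L_γ(u) = 0` on `[0,T) × ℝ`: `u` is smooth, `u(t,·)` and
`∂ₜu(t,·)` are Schwartz for each `t ∈ [0,T)` with all Schwartz seminorms locally bounded in
`t`, and the equation holds pointwise. -/
def IsSmoothSolution (p : ℕ) (γ : ℝ → ℝ) (T : ℝ) (u : ℝ → ℝ → ℝ) : Prop :=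
  ContDiffOn ℝ (⊤ : ℕ∞) (Function.uncurry u) (Set.Ico 0 T ×ˢ Set.univ) ∧
  (∀ t ∈ Set.Ico (0 : ℝ) T,
    IsSchwartzFn (u t) ∧ IsSchwartzFn (fun x => deriv (fun τ => u τ x) t)) ∧
  (∀ (k n : ℕ) (K : Set ℝ), IsCompact K → K ⊆ Set.Ico (0 : ℝ) T →
    ∃ B : ℝ, ∀ t ∈ K, ∀ x : ℝ,
      |x| ^ k * |iteratedDeriv n (u t) x| ≤ B ∧
      |x| ^ k * |iteratedDeriv n (fun y => deriv (fun τ => u τ y) t) x| ≤ B) ∧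
  (∀ t ∈ Set.Ico (0 : ℝ) T, ∀ x : ℝ,
    deriv (fun τ => u τ x) t + deriv (u t) x + iteratedDeriv 3 (u t) x
      + (u t x) ^ p * deriv (u t) x + Ldamp γ (u t) x = 0)

/-! ### Continuous, bounded, integrable functions -/

/-- Continuous, integrable and bounded real functions; they form a non-unital algebra. -/
def IntBdd (f : ℝ → ℝ) : Prop :=
  Continuous f ∧ Integrable f ∧ ∃ C : ℝ, ∀ x, |f x| ≤ C

namespace IntBdd

variable {f g : ℝ → ℝ}

lemma continuous (hf : IntBdd f) : Continuous f := hf.1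

lemma integrable (hf : IntBdd f) : Integrable f := hf.2.1

lemma mul (hf : IntBdd f) (hg : IntBdd g) : IntBdd (fun x => f x * g x) := by
  obtain ⟨C, hC⟩ := hf.2.2
  obtain ⟨D, hD⟩ := hg.2.2
  refine ⟨hf.1.mul hg.1, hg.integrable.bdd_mul hf.1.aestronglyMeasurable
    (Filter.Eventually.of_forall hC), C * D, fun x => ?_⟩
  rw [abs_mul]
  exact mul_le_mul (hC x) (hD x) (abs_nonneg _) ((abs_nonneg _).trans (hC x))

lemma add (hf : IntBdd f) (hg : IntBdd g) : IntBdd (fun x => f x + g x) := by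
  obtain ⟨C, hC⟩ := hf.2.2
  obtain ⟨D, hD⟩ := hg.2.2
  exact ⟨hf.1.add hg.1, hf.integrable.add hg.integrable, C + D, fun x =>
    (abs_add_le _ _).trans (add_le_add (hC x) (hD x))⟩

lemma const_mul (c : ℝ) (hf : IntBdd f) : IntBdd (fun x => c * f x) := by
  obtain ⟨C, hC⟩ := hf.2.2
  refine ⟨hf.1.const_mul c, hf.integrable.const_mul c, |c| * C, fun x => ?_⟩
  rw [abs_mul]
  exact mul_le_mul_of_nonneg_left (hC x) (abs_nonneg _)

lemma neg (hf : IntBdd f) : IntBdd (fun x => -f x) := by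
  simpa using hf.const_mul (-1)

lemma sub (hf : IntBdd f) (hg : IntBdd g) : IntBdd (fun x => f x - g x) := by
  simpa [sub_eq_add_neg] using hf.add hg.neg

lemma abs (hf : IntBdd f) : IntBdd (fun x => |f x|) :=
  ⟨hf.1.abs, hf.integrable.abs, by simpa using hf.2.2⟩

lemma pow (hf : IntBdd f) {n : ℕ} (hn : n ≠ 0) : IntBdd (fun x => f x ^ n) := by
  obtain ⟨k, rfl⟩ := Nat.exists_eq_succ_of_ne_zero hn
  induction k with
  | zero => simpa using hf
  | succ k ih => simpa [pow_succ] using (ih k.succ_ne_zero).mul hf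

end IntBdd

/-- The Cauchy–Schwarz inequality for integrals. -/
lemma sq_integral_mul_le {f g : ℝ → ℝ} (hf : IntBdd f) (hg : IntBdd g) :
    (∫ x, f x * g x) ^ 2 ≤ (∫ x, f x ^ 2) * ∫ x, g x ^ 2 := by
  have key : ∀ s : ℝ, 0 ≤ (∫ x, f x ^ 2) * (s * s) + (2 * ∫ x, f x * g x) * s
      + ∫ x, g x ^ 2 := by
    intro s
    have h : ∫ x, (s * f x + g x) ^ 2
        = (∫ x, f x ^ 2) * (s * s) + (2 * ∫ x, f x * g x) * s + ∫ x, g x ^ 2 := by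
      have hi1 := (hf.pow two_ne_zero).const_mul (s * s)
      have hi2 := (hf.mul hg).const_mul (2 * s)
      have hi3 := hg.pow two_ne_zero
      calc ∫ x, (s * f x + g x) ^ 2
          = ∫ x, ((s * s * f x ^ 2 + 2 * s * (f x * g x)) + g x ^ 2) := by
            congr 1; ext x; ring
        _ = _ := by
            rw [integral_add (hi1.add hi2).integrable hi3.integrable,
              integral_add hi1.integrable hi2.integrable, integral_const_mul,
              integral_const_mul]
            ring
    rw [← h]
    exact integral_nonneg fun x => sq_nonneg _
  have := discrim_le_zero key
  rw [discrim] at this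
  nlinarith

lemma sq_integral_abs_mul_le {f g : ℝ → ℝ} (hf : IntBdd f) (hg : IntBdd g) :
    (∫ x, |f x * g x|) ^ 2 ≤ (∫ x, f x ^ 2) * ∫ x, g x ^ 2 := by
  simpa [abs_mul] using sq_integral_mul_le hf.abs hg.abs

/-- The one-dimensional Agmon inequality. -/
lemma sq_le_integral_abs_mul {f f' : ℝ → ℝ} (hf : IntBdd f) (hf' : IntBdd f')
    (h : ∀ x, HasDerivAt f (f' x) x) (x : ℝ) : f x ^ 2 ≤ ∫ y, |f y * f' y| := by
  have hd : ∀ y, HasDerivAt (fun y => f y ^ 2) (2 * (f y * f' y)) y := fun y =>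
    ((h y).fun_pow 2).congr_deriv (by push_cast; ring)
  have hi := ((hf.mul hf').const_mul 2)
  have hi0 := (hf.pow two_ne_zero)
  have h1 := integral_Iic_of_hasDerivAt_of_tendsto' (a := x) (fun y _ => hd y)
    hi.integrable.integrableOn
    (tendsto_zero_of_hasDerivAt_of_integrableOn_Iic (a := 0) (fun y _ => hd y)
      hi.integrable.integrableOn hi0.integrable.integrableOn)
  have h2 := integral_Ioi_of_hasDerivAt_of_tendsto' (a := x) (fun y _ => hd y)
    hi.integrable.integrableOn
    (tendsto_zero_of_hasDerivAt_of_integrableOn_Ioi (a := 0) (fun y _ => hd y)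
      hi.integrable.integrableOn hi0.integrable.integrableOn)
  have h3 := integral_add_compl (measurableSet_Iic (a := x)) hi.abs.integrable
  rw [Set.compl_Iic] at h3
  have h4 := abs_integral_le_integral_abs (μ := volume.restrict (Set.Iic x))
    (f := fun y => 2 * (f y * f' y))
  have h5 := abs_integral_le_integral_abs (μ := volume.restrict (Set.Ioi x))
    (f := fun y => 2 * (f y * f' y))
  have h6 : ∫ y, |2 * (f y * f' y)| = 2 * ∫ y, |f y * f' y| := by
    simp only [abs_mul (2 : ℝ), abs_two, integral_const_mul]
  rw [h1] at h4
  rw [h2] at h5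
  have h7 := le_abs_self (f x ^ 2 - 0)
  have h8 := neg_le_abs (0 - f x ^ 2)
  linarith

/-! ### Schwartz functions -/

lemma iteratedDeriv_iteratedDeriv (f : ℝ → ℝ) (m n : ℕ) :
    iteratedDeriv m (iteratedDeriv n f) = iteratedDeriv (m + n) f := by
  simp [iteratedDeriv_eq_iterate, Function.iterate_add]

namespace IsSchwartzFn

variable {f : ℝ → ℝ}

/-- A Schwartz function, as an element of Mathlib's Schwartz space. -/
def toSchwartzMap (hf : IsSchwartzFn f) : SchwartzMap ℝ ℝ where
  toFun := f
  smooth' := hf.1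
  decay' k n := by
    simpa [norm_iteratedFDeriv_eq_norm_iteratedDeriv] using hf.2 k n

lemma iteratedDeriv (hf : IsSchwartzFn f) (n : ℕ) : IsSchwartzFn (iteratedDeriv n f) := by
  refine ⟨?_, fun k m => ?_⟩
  · rw [iteratedDeriv_eq_iterate]
    exact hf.1.iterate_deriv n
  · rw [iteratedDeriv_iteratedDeriv]
    exact hf.2 k (m + n)

lemma hasDerivAt_iteratedDeriv (hf : IsSchwartzFn f) (n : ℕ) (x : ℝ) :
    HasDerivAt (_root_.iteratedDeriv n f) (_root_.iteratedDeriv (n + 1) f x) x := by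
  rw [iteratedDeriv_succ]
  exact ((hf.iteratedDeriv n).1.differentiable (by simp) x).hasDerivAt

lemma intBdd (hf : IsSchwartzFn f) : IntBdd f :=
  ⟨hf.1.continuous, hf.toSchwartzMap.integrable, by simpa using hf.2 0 0⟩

lemma intBdd_iteratedDeriv (hf : IsSchwartzFn f) (n : ℕ) : IntBdd (_root_.iteratedDeriv n f) :=
  (hf.iteratedDeriv n).intBdd

lemma integral_mul_iteratedDeriv_succ {g : ℝ → ℝ} (hf : IsSchwartzFn f) (hg : IsSchwartzFn g)
    (m n : ℕ) :
    ∫ x, _root_.iteratedDeriv m f x * _root_.iteratedDeriv (n + 1) g x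
      = - ∫ x, _root_.iteratedDeriv (m + 1) f x * _root_.iteratedDeriv n g x := by
  have h1 := (hf.intBdd_iteratedDeriv (m + 1)).mul (hg.intBdd_iteratedDeriv n)
  have h2 := (hf.intBdd_iteratedDeriv m).mul (hg.intBdd_iteratedDeriv (n + 1))
  have := integral_eq_zero_of_hasDerivAt_of_integrable
    (fun x => (hf.hasDerivAt_iteratedDeriv m x).mul (hg.hasDerivAt_iteratedDeriv n x))
    (h1.add h2).integrable ((hf.intBdd_iteratedDeriv m).mul (hg.intBdd_iteratedDeriv n)).integrable
  rw [integral_add h1.integrable h2.integrable] at this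
  linarith

lemma integral_mul_iteratedDeriv_four {g : ℝ → ℝ} (hf : IsSchwartzFn f) (hg : IsSchwartzFn g) :
    ∫ x, f x * _root_.iteratedDeriv 4 g x
      = ∫ x, _root_.iteratedDeriv 2 f x * _root_.iteratedDeriv 2 g x := by
  have h1 := integral_mul_iteratedDeriv_succ hf hg 0 3
  have h2 := integral_mul_iteratedDeriv_succ hf hg 1 2
  simp only [iteratedDeriv_zero] at h1
  norm_num at h1 h2
  linarith

lemma integral_iteratedDeriv_mul_succ (hf : IsSchwartzFn f) (n : ℕ) :
    ∫ x, _root_.iteratedDeriv n f x * _root_.iteratedDeriv (n + 1) f x = 0 := by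
  have h := integral_mul_iteratedDeriv_succ hf hf n n
  simp only [mul_comm (_root_.iteratedDeriv (n + 1) f _)] at h
  linarith

lemma integral_iteratedDeriv_mul_add_three (hf : IsSchwartzFn f) (n : ℕ) :
    ∫ x, _root_.iteratedDeriv n f x * _root_.iteratedDeriv (n + 3) f x = 0 := by
  rw [integral_mul_iteratedDeriv_succ hf hf n (n + 2),
    integral_iteratedDeriv_mul_succ hf (n + 1), neg_zero]

lemma sq_integral_deriv_sq_le (hf : IsSchwartzFn f) :
    (∫ x, _root_.iteratedDeriv 1 f x ^ 2) ^ 2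
      ≤ (∫ x, f x ^ 2) * ∫ x, _root_.iteratedDeriv 2 f x ^ 2 := by
  have h := integral_mul_iteratedDeriv_succ hf hf 0 1
  simp only [zero_add, iteratedDeriv_zero, Nat.reduceAdd] at h
  have h' : ∫ x, _root_.iteratedDeriv 1 f x ^ 2 = - ∫ x, f x * _root_.iteratedDeriv 2 f x := by
    rw [h, neg_neg]; simp only [sq]
  rw [h', neg_sq]
  exact sq_integral_mul_le hf.intBdd (hf.intBdd_iteratedDeriv 2)

lemma pow_eight_le (hf : IsSchwartzFn f) (x : ℝ) :
    f x ^ 8 ≤ (∫ x, f x ^ 2) ^ 3 * ∫ x, _root_.iteratedDeriv 2 f x ^ 2 := by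
  have h0 := sq_le_integral_abs_mul hf.intBdd (hf.intBdd_iteratedDeriv 1)
    (by simpa using hf.hasDerivAt_iteratedDeriv 0) x
  have h1 := sq_integral_abs_mul_le hf.intBdd (hf.intBdd_iteratedDeriv 1)
  have h2 := hf.sq_integral_deriv_sq_le
  have hm : 0 ≤ ∫ x, f x ^ 2 := integral_nonneg fun x => sq_nonneg _
  have hk : 0 ≤ ∫ x, _root_.iteratedDeriv 1 f x ^ 2 := integral_nonneg fun x => sq_nonneg _
  calc f x ^ 8 = (f x ^ 2) ^ 4 := by ring
    _ ≤ (∫ y, |f y * _root_.iteratedDeriv 1 f y|) ^ 4 := by gcongr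
    _ = ((∫ y, |f y * _root_.iteratedDeriv 1 f y|) ^ 2) ^ 2 := by ring
    _ ≤ ((∫ x, f x ^ 2) * ∫ x, _root_.iteratedDeriv 1 f x ^ 2) ^ 2 := by gcongr
    _ = (∫ x, f x ^ 2) ^ 2 * (∫ x, _root_.iteratedDeriv 1 f x ^ 2) ^ 2 := by ring
    _ ≤ (∫ x, f x ^ 2) ^ 2 * ((∫ x, f x ^ 2) * ∫ x, _root_.iteratedDeriv 2 f x ^ 2) := by gcongr
    _ = _ := by ring

lemma deriv_pow_four_le (hf : IsSchwartzFn f) (x : ℝ) :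
    _root_.iteratedDeriv 1 f x ^ 4
      ≤ (∫ x, _root_.iteratedDeriv 1 f x ^ 2) * ∫ x, _root_.iteratedDeriv 2 f x ^ 2 := by
  have h0 := sq_le_integral_abs_mul (hf.intBdd_iteratedDeriv 1) (hf.intBdd_iteratedDeriv 2)
    (hf.hasDerivAt_iteratedDeriv 1) x
  have h1 := sq_integral_abs_mul_le (hf.intBdd_iteratedDeriv 1) (hf.intBdd_iteratedDeriv 2)
  calc _root_.iteratedDeriv 1 f x ^ 4 = (_root_.iteratedDeriv 1 f x ^ 2) ^ 2 := by ring
    _ ≤ (∫ y, |_root_.iteratedDeriv 1 f y * _root_.iteratedDeriv 2 f y|) ^ 2 := by gcongr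
    _ ≤ _ := h1

end IsSchwartzFn

/-! ### The nonlinear term -/

namespace IsSchwartzFn

variable {f : ℝ → ℝ}

lemma integral_pow_mul_deriv_mul (hf : IsSchwartzFn f) {p : ℕ} (hp : p ≠ 0) :
    ∫ x, f x ^ p * _root_.iteratedDeriv 1 f x * f x = 0 := by
  have h0 := hf.intBdd
  have h1 := hf.intBdd_iteratedDeriv 1
  have hd : ∀ x, HasDerivAt f (_root_.iteratedDeriv 1 f x) x := by
    simpa using hf.hasDerivAt_iteratedDeriv 0
  have hd' : ∀ x, HasDerivAt (fun x => f x ^ (p + 2))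
      (((p : ℝ) + 2) * (f x ^ p * _root_.iteratedDeriv 1 f x * f x)) x := fun x => by
    refine ((hd x).fun_pow (p + 2)).congr_deriv ?_
    push_cast
    ring
  have := integral_eq_zero_of_hasDerivAt_of_integrable hd'
    ((((h0.pow hp).mul h1).mul h0).const_mul _).integrable
    (h0.pow (by lia)).integrable
  rw [integral_const_mul] at this
  have hp' : (p : ℝ) + 2 ≠ 0 := by positivity
  exact (mul_eq_zero.1 this).resolve_left hp'

lemma integral_pow_mul_deriv_mul_iteratedDeriv_four (hf : IsSchwartzFn f) {q : ℕ} (hq : q ≠ 0) :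
    ∫ x, f x ^ (q + 2) * _root_.iteratedDeriv 1 f x * _root_.iteratedDeriv 4 f x
      = 5 * (q + 2) / 2 * (∫ x, f x ^ (q + 1) * _root_.iteratedDeriv 1 f x
          * _root_.iteratedDeriv 2 f x ^ 2)
        + (q + 2) * (q + 1) * ∫ x, f x ^ q * (_root_.iteratedDeriv 1 f x ^ 3
          * _root_.iteratedDeriv 2 f x) := by
  have h0 := hf.intBdd
  have h1 := hf.intBdd_iteratedDeriv 1
  have h2 := hf.intBdd_iteratedDeriv 2
  have h3 := hf.intBdd_iteratedDeriv 3
  have h4 := hf.intBdd_iteratedDeriv 4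
  have d0 : ∀ x, HasDerivAt f (_root_.iteratedDeriv 1 f x) x := by
    simpa using hf.hasDerivAt_iteratedDeriv 0
  have d1 := hf.hasDerivAt_iteratedDeriv 1
  have d2 := hf.hasDerivAt_iteratedDeriv 2
  have d3 := hf.hasDerivAt_iteratedDeriv 3
  have i1 := ((h0.pow (q + 1).succ_ne_zero).mul h1).mul h4
  have i2 := (((h0.pow q.succ_ne_zero).mul h1).mul (h2.pow two_ne_zero)).const_mul
    (5 * (q + 2) / 2)
  have i3 := ((h0.pow hq).mul ((h1.pow three_ne_zero).mul h2)).const_mul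
    (((q : ℝ) + 2) * (q + 1))
  have hd : ∀ x, HasDerivAt (fun x => f x ^ (q + 2) * _root_.iteratedDeriv 1 f x
        * _root_.iteratedDeriv 3 f x
      - ((q : ℝ) + 2) * (f x ^ (q + 1) * _root_.iteratedDeriv 1 f x ^ 2
        * _root_.iteratedDeriv 2 f x)
      - 1 / 2 * (f x ^ (q + 2) * _root_.iteratedDeriv 2 f x ^ 2))
      (f x ^ (q + 2) * _root_.iteratedDeriv 1 f x * _root_.iteratedDeriv 4 f x
      - 5 * (q + 2) / 2 * (f x ^ (q + 1) * _root_.iteratedDeriv 1 f x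
          * _root_.iteratedDeriv 2 f x ^ 2)
      - (q + 2) * (q + 1) * (f x ^ q * (_root_.iteratedDeriv 1 f x ^ 3
          * _root_.iteratedDeriv 2 f x))) x := fun x => by
    refine ((((((d0 x).fun_pow (q + 2)).fun_mul (d1 x)).fun_mul (d3 x)).fun_sub
      (((((d0 x).fun_pow (q + 1)).fun_mul ((d1 x).fun_pow 2)).fun_mul (d2 x)).const_mul
        ((q : ℝ) + 2))).fun_sub
      ((((d0 x).fun_pow (q + 2)).fun_mul ((d2 x).fun_pow 2)).const_mul (1 / 2))).congr_deriv ?_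
    push_cast
    ring
  have hz := integral_eq_zero_of_hasDerivAt_of_integrable hd ((i1.sub i2).sub i3).integrable
    (((((h0.pow (q + 1).succ_ne_zero).mul h1).mul h3).sub
      ((((h0.pow q.succ_ne_zero).mul (h1.pow two_ne_zero)).mul h2).const_mul _)).sub
      (((h0.pow (q + 1).succ_ne_zero).mul (h2.pow two_ne_zero)).const_mul _)).integrable
  rw [integral_sub (i1.sub i2).integrable i3.integrable, integral_sub i1.integrable i2.integrable,
    integral_const_mul, integral_const_mul] at hz
  linarith

lemma neg_integral_nonlinear_le (hf : IsSchwartzFn f) {p : ℕ} (hp : 4 ≤ p) {m k : ℝ}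
    (hm : ∫ x, f x ^ 2 ≤ m) (hk : ∫ x, _root_.iteratedDeriv 2 f x ^ 2 ≤ 2 * k) :
    - ∫ x, f x ^ p * _root_.iteratedDeriv 1 f x * _root_.iteratedDeriv 4 f x
      ≤ Omega p (√m) (√k) * ∫ x, _root_.iteratedDeriv 2 f x ^ 2 := by
  set A := ∫ x, f x ^ 2 with hA
  set B := ∫ x, _root_.iteratedDeriv 2 f x ^ 2 with hB
  have hA0 : 0 ≤ A := integral_nonneg fun x => sq_nonneg _
  have hB0 : 0 ≤ B := integral_nonneg fun x => sq_nonneg _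
  have hm0 : 0 ≤ m := hA0.trans hm
  have hk0 : 0 ≤ k := by linarith
  obtain ⟨q, rfl⟩ := Nat.exists_eq_add_of_le' (show 2 ≤ p by lia)
  have hq : q ≠ 0 := by lia
  set a := √m with ha
  set b := √k with hb
  have ha0 : 0 ≤ a := Real.sqrt_nonneg _
  have hb0 : 0 ≤ b := Real.sqrt_nonneg _
  have ham : a ^ 2 = m := Real.sq_sqrt hm0
  have hbk : b ^ 2 = k := Real.sq_sqrt hk0
  set Q := 2 * a ^ (3 / 2 : ℝ) * b ^ (1 / 2 : ℝ) with hQ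
  have hQ0 : 0 ≤ Q := by positivity
  have hQ4 : Q ^ 4 = 16 * (m ^ 3 * k) := by
    rw [hQ, mul_pow, mul_pow, ← Real.rpow_mul_natCast ha0, ← Real.rpow_mul_natCast hb0, ← ham,
      ← hbk]
    norm_num
    ring
  set V := √2 * a ^ (1 / 4 : ℝ) * b ^ (3 / 4 : ℝ) with hV
  have hV0 : 0 ≤ V := by positivity
  have hV8 : V ^ 8 = 16 * (m * k ^ 3) := by
    rw [hV, mul_pow, mul_pow, ← Real.rpow_mul_natCast ha0, ← Real.rpow_mul_natCast hb0, ← ham,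
      ← hbk, show √2 ^ 8 = (√2 ^ 2) ^ 4 by ring, Real.sq_sqrt (by norm_num)]
    norm_num
    ring
  have hfQ : ∀ x, |f x| ≤ √Q := by
    intro x
    refine le_of_pow_le_pow_left₀ (n := 8) (by norm_num) (Real.sqrt_nonneg _) ?_
    rw [show √Q ^ 8 = (√Q ^ 2) ^ 4 by ring, Real.sq_sqrt hQ0, hQ4,
      Even.pow_abs (by decide)]
    calc f x ^ 8 ≤ A ^ 3 * B := hf.pow_eight_le x
      _ ≤ m ^ 3 * (2 * k) := by gcongr
      _ ≤ 16 * (m ^ 3 * k) := by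
        have : 0 ≤ m ^ 3 * k := by positivity
        linarith
  have hQpow : ∀ n : ℕ, √Q ^ n = Q ^ ((n : ℝ) / 2) := by
    intro n
    rw [Real.sqrt_eq_rpow, ← Real.rpow_mul_natCast hQ0]
    congr 1; ring
  set D := ∫ x, _root_.iteratedDeriv 1 f x ^ 2 with hD
  have hD0 : 0 ≤ D := integral_nonneg fun x => sq_nonneg _
  have hDAB : D ^ 2 ≤ A * B := hf.sq_integral_deriv_sq_le
  have hf1V : ∀ x, |_root_.iteratedDeriv 1 f x| ≤ V := by
    intro x
    refine le_of_pow_le_pow_left₀ (n := 8) (by norm_num) hV0 ?_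
    rw [hV8, Even.pow_abs (by decide)]
    calc _root_.iteratedDeriv 1 f x ^ 8 = (_root_.iteratedDeriv 1 f x ^ 4) ^ 2 := by ring
      _ ≤ (D * B) ^ 2 := by
        gcongr
        exact hf.deriv_pow_four_le x
      _ = D ^ 2 * B ^ 2 := by ring
      _ ≤ (A * B) * B ^ 2 := by gcongr
      _ = A * B ^ 3 := by ring
      _ ≤ m * (2 * k) ^ 3 := by gcongr
      _ ≤ 16 * (m * k ^ 3) := by
        have : 0 ≤ m * k ^ 3 := by positivity
        nlinarith
  have h0 := hf.intBdd
  have h1 := hf.intBdd_iteratedDeriv 1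
  have h2 := hf.intBdd_iteratedDeriv 2
  have hI1 : |∫ x, f x ^ (q + 1) * _root_.iteratedDeriv 1 f x * _root_.iteratedDeriv 2 f x ^ 2|
      ≤ √Q ^ (q + 1) * V * B := by
    rw [hB, ← integral_const_mul]
    refine abs_integral_le_integral_abs.trans (integral_mono
      (((h0.pow q.succ_ne_zero).mul h1).mul (h2.pow two_ne_zero)).abs.integrable
      ((h2.pow two_ne_zero).const_mul _).integrable fun x => ?_)
    simp only [abs_mul, abs_pow, sq_abs]
    gcongr
    exacts [hfQ x, hf1V x]
  have hI2 : |∫ x, f x ^ q * (_root_.iteratedDeriv 1 f x ^ 3 * _root_.iteratedDeriv 2 f x)|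
      ≤ √Q ^ q * (2 * a * b) * B := by
    set J := ∫ x, |_root_.iteratedDeriv 1 f x * _root_.iteratedDeriv 2 f x| with hJ
    have hJ0 : 0 ≤ J := integral_nonneg fun x => abs_nonneg _
    have hJ2 : J ^ 2 ≤ D * B := sq_integral_abs_mul_le h1 h2
    have hf1J : ∀ x, _root_.iteratedDeriv 1 f x ^ 2 ≤ J := fun x =>
      sq_le_integral_abs_mul h1 h2 (hf.hasDerivAt_iteratedDeriv 1) x
    have hD2 : D ≤ 2 * a * b := by
      refine le_of_pow_le_pow_left₀ two_ne_zero (by positivity) ?_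
      calc D ^ 2 ≤ m * (2 * k) := hDAB.trans (by gcongr)
        _ ≤ 4 * (m * k) := by
          have : 0 ≤ m * k := by positivity
          linarith
        _ = (2 * a * b) ^ 2 := by rw [← ham, ← hbk]; ring
    have hJJ : |∫ x, f x ^ q * (_root_.iteratedDeriv 1 f x ^ 3 * _root_.iteratedDeriv 2 f x)|
        ≤ (√Q ^ q * J) * J := by
      conv_rhs => rw [hJ, ← integral_const_mul]
      refine abs_integral_le_integral_abs.trans (integral_mono
        ((h0.pow hq).mul ((h1.pow three_ne_zero).mul h2)).abs.integrable
        ((h1.mul h2).abs.const_mul _).integrable fun x => ?_)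
      calc |f x ^ q * (_root_.iteratedDeriv 1 f x ^ 3 * _root_.iteratedDeriv 2 f x)|
          = |f x| ^ q * _root_.iteratedDeriv 1 f x ^ 2
              * |_root_.iteratedDeriv 1 f x * _root_.iteratedDeriv 2 f x| := by
            simp only [abs_mul, abs_pow, ← sq_abs (_root_.iteratedDeriv 1 f x)]
            ring
        _ ≤ _ := by
          gcongr
          exacts [hfQ x, hf1J x]
    calc _ ≤ √Q ^ q * J ^ 2 := hJJ.trans_eq (by ring)
      _ ≤ √Q ^ q * (D * B) := by gcongr
      _ ≤ √Q ^ q * ((2 * a * b) * B) := by gcongr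
      _ = _ := by ring
  rw [hf.integral_pow_mul_deriv_mul_iteratedDeriv_four hq]
  have hO : Omega (q + 2) a b * B = 5 * (q + 2) / 2 * (√Q ^ (q + 1) * V * B)
      + (q + 2) * (q + 1) * (√Q ^ q * (2 * a * b) * B) := by
    rw [Omega, ← hQ, hQpow, hQpow, hV]
    push_cast
    rw [show (q : ℝ) + 2 - 1 = q + 1 by ring, show (q : ℝ) + 2 - 2 = q by ring]
    ring
  rw [hO]
  have e1 := mul_le_mul_of_nonneg_left ((neg_le_abs _).trans hI1)
    (show (0 : ℝ) ≤ 5 * (q + 2) / 2 by positivity)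
  have e2 := mul_le_mul_of_nonneg_left ((neg_le_abs _).trans hI2)
    (show (0 : ℝ) ≤ (q + 2) * (q + 1) by positivity)
  linarith

end IsSchwartzFn

/-! ### The damping operator -/

open scoped FourierTransform in
lemma FTr_eq_fourier (f : ℝ → ℝ) (ξ : ℝ) :
    FTr f ξ = 𝓕 (fun x => (f x : ℂ)) (ξ / (2 * Real.pi)) := by
  rw [Real.fourier_real_eq_integral_exp_smul, FTr, FTc]
  congr 1
  ext x
  rw [smul_eq_mul, mul_comm]
  congr 2
  have : (Real.pi : ℂ) ≠ 0 := by exact_mod_cast Real.pi_ne_zero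
  push_cast
  field_simp

lemma PolyBounded.mul {γ δ : ℝ → ℝ} (hγ : PolyBounded γ) (hδ : PolyBounded δ) :
    PolyBounded (fun ξ => γ ξ * δ ξ) := by
  obtain ⟨C, n, hC⟩ := hγ
  obtain ⟨D, m, hD⟩ := hδ
  refine ⟨C * D, n + m, fun ξ => ?_⟩
  rw [abs_mul]
  calc |γ ξ| * |δ ξ| ≤ (C * (1 + |ξ|) ^ n) * (D * (1 + |ξ|) ^ m) :=
        mul_le_mul (hC ξ) (hD ξ) (abs_nonneg _) ((abs_nonneg _).trans (hC ξ))
    _ = _ := by ring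

lemma polyBounded_pow (n : ℕ) : PolyBounded (fun ξ => ξ ^ n) :=
  ⟨1, n, fun ξ => by rw [abs_pow, one_mul]; gcongr; linarith [abs_nonneg ξ]⟩

lemma polyBounded_const (c : ℝ) : PolyBounded (fun _ => c) := ⟨|c|, 0, fun ξ => by simp⟩

namespace IsSchwartzFn

variable {f g : ℝ → ℝ}

/-- The complexification of a real Schwartz function. -/
noncomputable def toComplexSchwartzMap (hf : IsSchwartzFn f) : SchwartzMap ℝ ℂ :=
  hf.toSchwartzMap.postcompCLM Complex.ofRealCLM

open scoped FourierTransform in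
lemma FTr_eq (hf : IsSchwartzFn f) (ξ : ℝ) :
    FTr f ξ = (𝓕 hf.toComplexSchwartzMap) (ξ / (2 * Real.pi)) := by
  rw [FTr_eq_fourier, SchwartzMap.fourier_coe]
  rfl

lemma continuous_FTr (hf : IsSchwartzFn f) : Continuous (FTr f) := by
  rw [funext hf.FTr_eq]
  exact (SchwartzMap.continuous _).comp (continuous_id.div_const _)

lemma norm_FTr_le (hf : IsSchwartzFn f) (n : ℕ) :
    ∃ C : ℝ, ∀ ξ, (1 + |ξ|) ^ n * ‖FTr f ξ‖ ≤ C := by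
  obtain ⟨C, hC⟩ : ∃ C : ℝ, ∀ ξ, (1 + ‖ξ / (2 * Real.pi)‖) ^ n * ‖FTr f ξ‖ ≤ C := by
    have H := SchwartzMap.one_add_le_sup_seminorm_apply (𝕜 := ℝ) (m := (n, 0)) (k := n) (n := 0)
      le_rfl le_rfl (FourierTransform.fourier hf.toComplexSchwartzMap)
    simp only [norm_iteratedFDeriv_zero] at H
    exact ⟨_, fun ξ => (Eq.le (by rw [hf.FTr_eq])).trans (H (ξ / (2 * Real.pi)))⟩
  refine ⟨(2 * Real.pi) ^ n * C, fun ξ => ?_⟩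
  have hpi : 1 ≤ 2 * Real.pi := by linarith [Real.pi_gt_three]
  calc (1 + |ξ|) ^ n * ‖FTr f ξ‖
      ≤ ((2 * Real.pi) * (1 + ‖ξ / (2 * Real.pi)‖)) ^ n * ‖FTr f ξ‖ := by
        gcongr
        rw [Real.norm_eq_abs, abs_div, abs_of_pos (by positivity : (0 : ℝ) < 2 * Real.pi),
          mul_add, mul_div_cancel₀ _ (by positivity)]
        linarith
    _ = (2 * Real.pi) ^ n * ((1 + ‖ξ / (2 * Real.pi)‖) ^ n * ‖FTr f ξ‖) := by rw [mul_pow, mul_assoc]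
    _ ≤ _ := mul_le_mul_of_nonneg_left (hC ξ) (by positivity)

lemma integrable_mul_FTr (hf : IsSchwartzFn f) {γ : ℝ → ℝ} (hγ : Measurable γ)
    (hb : PolyBounded γ) : Integrable (fun ξ => (γ ξ : ℂ) * FTr f ξ) := by
  obtain ⟨C, n, hC⟩ := hb
  obtain ⟨D, hD⟩ := hf.norm_FTr_le (n + 2)
  refine (integrable_inv_one_add_sq.const_mul (C * D)).mono'
    ((Complex.measurable_ofReal.comp hγ).aestronglyMeasurable.mul
      hf.continuous_FTr.aestronglyMeasurable) (Filter.Eventually.of_forall fun ξ => ?_)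
  have hC0 : 0 ≤ C := by
    have := (abs_nonneg _).trans (hC 0)
    simpa using this
  rw [norm_mul, Complex.norm_real, Real.norm_eq_abs, ← div_eq_mul_inv,
    le_div_iff₀ (by positivity)]
  calc |γ ξ| * ‖FTr f ξ‖ * (1 + ξ ^ 2)
      ≤ (C * (1 + |ξ|) ^ n) * ‖FTr f ξ‖ * (1 + |ξ|) ^ 2 := by
        gcongr
        · exact hC ξ
        · nlinarith [abs_nonneg ξ, sq_abs ξ]
    _ = C * ((1 + |ξ|) ^ (n + 2) * ‖FTr f ξ‖) := by ring
    _ ≤ C * D := mul_le_mul_of_nonneg_left (hD ξ) hC0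

lemma integrable_mul_norm_FTr_sq (hf : IsSchwartzFn f) {γ : ℝ → ℝ} (hγ : Measurable γ)
    (hb : PolyBounded γ) : Integrable (fun ξ => γ ξ * ‖FTr f ξ‖ ^ 2) := by
  obtain ⟨D, hD⟩ := hf.norm_FTr_le 0
  have h := (hf.integrable_mul_FTr hγ hb).bdd_mul (f := fun ξ => starRingEnd ℂ (FTr f ξ)) (c := D)
    (Complex.continuous_conj.comp hf.continuous_FTr).aestronglyMeasurable
    (Filter.Eventually.of_forall fun ξ => by simpa using hD ξ)
  refine h.re.congr (Filter.Eventually.of_forall fun ξ => ?_)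
  have : starRingEnd ℂ (FTr f ξ) * ((γ ξ : ℂ) * FTr f ξ) = ((γ ξ * ‖FTr f ξ‖ ^ 2 : ℝ) : ℂ) := by
    rw [mul_left_comm, mul_comm (starRingEnd ℂ _), Complex.mul_conj']
    push_cast
    ring
  simp only [this]
  exact Complex.ofReal_re _

lemma FTr_iteratedDeriv (hf : IsSchwartzFn f) (n : ℕ) (ξ : ℝ) :
    FTr (_root_.iteratedDeriv n f) ξ = (Complex.I * ξ) ^ n * FTr f ξ := by
  induction n with
  | zero => simp
  | succ n ih =>
    have hd : ∀ x, HasDerivAt (fun x => ((_root_.iteratedDeriv n f x : ℝ) : ℂ))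
        ((_root_.iteratedDeriv (n + 1) f x : ℝ) : ℂ) x :=
      fun x => (hf.hasDerivAt_iteratedDeriv n x).ofReal_comp
    have hd' : deriv (fun x => ((_root_.iteratedDeriv n f x : ℝ) : ℂ))
        = fun x => ((_root_.iteratedDeriv (n + 1) f x : ℝ) : ℂ) := funext fun x => (hd x).deriv
    have h := Real.fourier_deriv (hf.intBdd_iteratedDeriv n).integrable.ofReal
      (fun x => (hd x).differentiableAt)
      (by rw [hd']; exact (hf.intBdd_iteratedDeriv (n + 1)).integrable.ofReal)
    rw [hd'] at h
    rw [FTr_eq_fourier, h]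
    beta_reduce
    rw [← FTr_eq_fourier, ih]
    have : (Real.pi : ℂ) ≠ 0 := by exact_mod_cast Real.pi_ne_zero
    push_cast
    rw [smul_eq_mul]
    field_simp
    ring

lemma conj_FTr (g : ℝ → ℝ) (ξ : ℝ) :
    starRingEnd ℂ (FTr g ξ) = ∫ x : ℝ, (g x : ℂ) * Complex.exp (Complex.I * ξ * x) := by
  rw [FTr, FTc, ← integral_conj]
  congr 1
  ext x
  rw [map_mul, ← Complex.exp_conj]
  simp

lemma integrable_prod_Ldamp (hf : IsSchwartzFn f) (hg : IsSchwartzFn g) {γ : ℝ → ℝ}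
    (hγ : Measurable γ) (hb : PolyBounded γ) :
    Integrable (fun z : ℝ × ℝ => (γ z.2 : ℂ) * FTr f z.2
      * ((g z.1 : ℂ) * Complex.exp (Complex.I * z.2 * z.1))) (volume.prod volume) := by
  have h := (hg.intBdd.integrable.ofReal (𝕜 := ℂ)).mul_prod (hf.integrable_mul_FTr hγ hb)
  have h' := h.bdd_mul (f := fun z : ℝ × ℝ => Complex.exp (Complex.I * z.2 * z.1)) (c := 1)
    (by fun_prop) (Filter.Eventually.of_forall fun z => by
      rw [mul_assoc, mul_comm, ← Complex.ofReal_mul, Complex.norm_exp_ofReal_mul_I])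
  refine h'.congr (Filter.Eventually.of_forall fun z => ?_)
  simp only [RCLike.ofReal_eq_complex_ofReal]
  ring

lemma Ldamp_mul_eq (f g γ : ℝ → ℝ) (x : ℝ) :
    Ldamp γ f x * g x = (1 / (2 * Real.pi)) * (∫ ξ : ℝ, (γ ξ : ℂ) * FTr f ξ
      * ((g x : ℂ) * Complex.exp (Complex.I * ξ * x))).re := by
  have : ∫ ξ : ℝ, (γ ξ : ℂ) * FTr f ξ * ((g x : ℂ) * Complex.exp (Complex.I * ξ * x))
      = (g x : ℂ) * ∫ ξ : ℝ, (γ ξ : ℂ) * FTr f ξ * Complex.exp (Complex.I * ξ * x) := by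
    rw [← integral_const_mul]
    congr 1
    ext ξ
    ring
  rw [this, Complex.re_ofReal_mul, Ldamp]
  ring

lemma integrable_Ldamp_mul (hf : IsSchwartzFn f) (hg : IsSchwartzFn g) {γ : ℝ → ℝ}
    (hγ : Measurable γ) (hb : PolyBounded γ) : Integrable (fun x => Ldamp γ f x * g x) := by
  simp only [Ldamp_mul_eq]
  exact ((hf.integrable_prod_Ldamp hg hγ hb).integral_prod_left).re.const_mul _

lemma integral_Ldamp_mul (hf : IsSchwartzFn f) (hg : IsSchwartzFn g) {γ : ℝ → ℝ}
    (hγ : Measurable γ) (hb : PolyBounded γ) :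
    ∫ x, Ldamp γ f x * g x = (1 / (2 * Real.pi))
      * (∫ ξ : ℝ, (γ ξ : ℂ) * FTr f ξ * starRingEnd ℂ (FTr g ξ)).re := by
  have hp := hf.integrable_prod_Ldamp hg hγ hb
  simp only [Ldamp_mul_eq]
  rw [integral_const_mul]
  congr 1
  have h1 := integral_re (hp.integral_prod_left)
  simp only [RCLike.re_eq_complex_re] at h1
  rw [h1, integral_integral_swap hp]
  congr 2
  ext ξ
  rw [integral_const_mul, conj_FTr]

lemma integral_Ldamp_mul_iteratedDeriv (hf : IsSchwartzFn f) {γ : ℝ → ℝ} (hγ : Measurable γ)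
    (hb : PolyBounded γ) {n : ℕ} (hn : Complex.I ^ n = 1) :
    ∫ x, Ldamp γ f x * _root_.iteratedDeriv n f x
      = (1 / (2 * Real.pi)) * ∫ ξ : ℝ, γ ξ * ξ ^ n * ‖FTr f ξ‖ ^ 2 := by
  rw [hf.integral_Ldamp_mul (hf.iteratedDeriv n) hγ hb]
  congr 1
  rw [← Complex.ofReal_re (∫ ξ : ℝ, γ ξ * ξ ^ n * ‖FTr f ξ‖ ^ 2), ← integral_complex_ofReal]
  congr 2
  ext ξ
  rw [hf.FTr_iteratedDeriv, mul_pow, hn, one_mul, map_mul, map_pow, Complex.conj_ofReal,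
    mul_left_comm, mul_assoc, Complex.mul_conj']
  push_cast
  ring

open scoped FourierTransform in
lemma Ldamp_one (hf : IsSchwartzFn f) : Ldamp (fun _ => 1) f = f := by
  ext x
  have hx : (f x : ℂ) = (𝓕⁻ (𝓕 hf.toComplexSchwartzMap)) x := by
    rw [FourierTransform.fourierInv_fourier_eq]
    rfl
  rw [SchwartzMap.fourierInv_coe, Real.fourierInv_eq'] at hx
  have hs := Measure.integral_comp_div (fun η : ℝ =>
    Complex.exp ((2 * Real.pi * (inner ℝ η x) : ℝ) * Complex.I)
      • (𝓕 hf.toComplexSchwartzMap) η) (2 * Real.pi)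
  rw [← hx] at hs
  have he : ∫ ξ : ℝ, ((1 : ℝ) : ℂ) * FTr f ξ * Complex.exp (Complex.I * ξ * x)
      = |2 * Real.pi| • (f x : ℂ) := by
    rw [← hs]
    congr 1
    ext ξ
    rw [hf.FTr_eq, smul_eq_mul, Complex.ofReal_one, one_mul, mul_comm]
    congr 2
    have : (Real.pi : ℂ) ≠ 0 := by exact_mod_cast Real.pi_ne_zero
    simp
    field_simp
  rw [Ldamp, he, abs_of_pos (by positivity), Complex.smul_re, Complex.ofReal_re, smul_eq_mul]
  field_simp

lemma integral_Ldamp_mul_self_nonneg (hf : IsSchwartzFn f) {γ : ℝ → ℝ} (hγ : Measurable γ)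
    (hb : PolyBounded γ) (hnn : ∀ ξ, 0 ≤ γ ξ) : 0 ≤ ∫ x, Ldamp γ f x * f x := by
  have h := hf.integral_Ldamp_mul_iteratedDeriv hγ hb (n := 0) (pow_zero _)
  rw [iteratedDeriv_zero] at h
  rw [h]
  refine mul_nonneg (by positivity) (integral_nonneg fun ξ => ?_)
  have := hnn ξ
  positivity

lemma mul_integral_le_integral_Ldamp_mul (hf : IsSchwartzFn f) {γ : ℝ → ℝ} (hγ : Measurable γ)
    (hb : PolyBounded γ) {θ : ℝ} (hθ : ∀ ξ, θ ≤ γ ξ) :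
    θ * (∫ x, _root_.iteratedDeriv 2 f x ^ 2)
      ≤ ∫ x, Ldamp γ f x * _root_.iteratedDeriv 4 f x := by
  have h1 := hf.integral_Ldamp_mul_iteratedDeriv measurable_const (polyBounded_const 1)
    Complex.I_pow_four
  rw [hf.Ldamp_one, hf.integral_mul_iteratedDeriv_four hf] at h1
  simp only [← sq] at h1
  rw [h1, hf.integral_Ldamp_mul_iteratedDeriv hγ hb Complex.I_pow_four, mul_left_comm]
  refine mul_le_mul_of_nonneg_left ?_ (by positivity)
  rw [← integral_const_mul]
  refine integral_mono ?_ (hf.integrable_mul_norm_FTr_sq (hγ.mul (measurable_id.pow_const 4))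
    (hb.mul (polyBounded_pow 4))) fun ξ => ?_
  · exact (hf.integrable_mul_norm_FTr_sq (measurable_const.mul (measurable_id.pow_const 4))
      ((polyBounded_const 1).mul (polyBounded_pow 4))).const_mul θ
  · have : θ * (ξ ^ 4 * ‖FTr f ξ‖ ^ 2) ≤ γ ξ * (ξ ^ 4 * ‖FTr f ξ‖ ^ 2) :=
      mul_le_mul_of_nonneg_right (hθ ξ) (by positivity)
    simpa [mul_assoc] using this

end IsSchwartzFn

/-! ### Time evolution -/

/-- Spatial derivatives preserve smoothness on a space-time strip. -/
lemma contDiffOn_uncurry_iteratedDeriv {F : ℝ → ℝ → ℝ} {T : ℝ}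
    (hF : ContDiffOn ℝ (⊤ : ℕ∞) (Function.uncurry F) (Set.Ico 0 T ×ˢ Set.univ)) (n : ℕ) :
    ContDiffOn ℝ (⊤ : ℕ∞) (Function.uncurry fun t => iteratedDeriv n (F t))
      (Set.Ico 0 T ×ˢ Set.univ) := by
  induction n with
  | zero => simpa using hF
  | succ n ih =>
    have hS : UniqueDiffOn ℝ (Set.Ico 0 T ×ˢ (Set.univ : Set ℝ)) :=
      (uniqueDiffOn_Ico 0 T).prod uniqueDiffOn_univ
    have hd : ContDiffOn ℝ (⊤ : ℕ∞) (fun z => fderivWithin ℝ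
        (Function.uncurry fun t => iteratedDeriv n (F t)) (Set.Ico 0 T ×ˢ Set.univ) z (0, 1))
        (Set.Ico 0 T ×ˢ Set.univ) :=
      (ih.fderivWithin hS (by simp)).clm_apply contDiffOn_const
    refine hd.congr ?_
    rintro ⟨t, x⟩ hz
    have h1 := (ih.differentiableOn (by simp) _ hz).hasFDerivWithinAt
    have h2 : HasDerivAt (fun y : ℝ => (t, y)) (0, 1) x :=
      (hasDerivAt_const x t).prodMk (hasDerivAt_id x)
    have h3 := h1.comp_hasDerivAt x h2
      (Filter.Eventually.of_forall fun y => ⟨hz.1, Set.mem_univ y⟩)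
    simp only [Function.uncurry_apply_pair, iteratedDeriv_succ]
    exact h3.deriv

namespace IsSmoothSolution

variable {p : ℕ} {γ : ℝ → ℝ} {T : ℝ} {u : ℝ → ℝ → ℝ}

lemma isSchwartzFn (hu : IsSmoothSolution p γ T u) {t : ℝ} (ht : t ∈ Set.Ico 0 T) :
    IsSchwartzFn (u t) := (hu.2.1 t ht).1

lemma continuousOn_iteratedDeriv (hu : IsSmoothSolution p γ T u) (n : ℕ) (x : ℝ) :
    ContinuousOn (fun t => iteratedDeriv n (u t) x) (Set.Ico 0 T) :=
  (contDiffOn_uncurry_iteratedDeriv hu.1 n).continuousOn.comp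
    (f := fun t : ℝ => (t, x)) (by fun_prop) fun _ ht => ⟨ht, Set.mem_univ x⟩

lemma hasDerivAt_time (hu : IsSmoothSolution p γ T u) {t : ℝ} (ht : t ∈ Set.Ioo 0 T) (x : ℝ) :
    HasDerivAt (fun τ => u τ x) (deriv (fun τ => u τ x) t) t := by
  have h1 : ContDiffAt ℝ (⊤ : ℕ∞) (Function.uncurry u) (t, x) :=
    hu.1.contDiffAt (prod_mem_nhds (Ico_mem_nhds ht.1 ht.2) Filter.univ_mem)
  have h2 : DifferentiableAt ℝ (fun τ : ℝ => (τ, x)) t := by fun_prop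
  exact ((h1.differentiableAt (by simp)).comp t h2).hasDerivAt

lemma exists_bound (hu : IsSmoothSolution p γ T u) (n : ℕ) {K : Set ℝ} (hK : IsCompact K)
    (hKT : K ⊆ Set.Ico 0 T) :
    ∃ B : ℝ, 0 ≤ B ∧ ∀ t ∈ K, ∀ x, |iteratedDeriv n (u t) x| ≤ B * (1 + x ^ 2)⁻¹ ∧
      |iteratedDeriv n (fun y => deriv (fun τ => u τ y) t) x| ≤ B * (1 + x ^ 2)⁻¹ := by
  obtain ⟨B, hB⟩ := hu.2.2.1 0 n K hK hKT
  obtain ⟨D, hD⟩ := hu.2.2.1 2 n K hK hKT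
  refine ⟨|B| + |D|, by positivity, fun t ht x => ?_⟩
  have hB' := hB t ht x
  have hD' := hD t ht x
  rw [← div_eq_mul_inv, le_div_iff₀ (by positivity), le_div_iff₀ (by positivity)]
  simp only [pow_zero, one_mul, sq_abs] at hB' hD'
  have := le_abs_self B
  have := le_abs_self D
  constructor <;> linarith [hB'.1, hB'.2, hD'.1, hD'.2]

lemma continuousOn_integral_mul (hu : IsSmoothSolution p γ T u) (m n : ℕ) {b : ℝ} (hb : b < T) :
    ContinuousOn (fun t => ∫ x, iteratedDeriv m (u t) x * iteratedDeriv n (u t) x)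
      (Set.Icc 0 b) := by
  have hKT : Set.Icc 0 b ⊆ Set.Ico 0 T := fun t ht => ⟨ht.1, ht.2.trans_lt hb⟩
  obtain ⟨B, hB0, hB⟩ := hu.exists_bound m isCompact_Icc hKT
  obtain ⟨D, hD0, hD⟩ := hu.exists_bound n isCompact_Icc hKT
  refine continuousOn_of_dominated (bound := fun x => B * D * (1 + x ^ 2)⁻¹) (fun t ht => ?_)
    (fun t ht => Filter.Eventually.of_forall fun x => ?_) (integrable_inv_one_add_sq.const_mul _)
    (Filter.Eventually.of_forall fun x => ?_)
  · have h := hu.isSchwartzFn (hKT ht)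
    exact ((h.intBdd_iteratedDeriv m).mul (h.intBdd_iteratedDeriv n)).continuous.aestronglyMeasurable
  · have hx : (1 + x ^ 2)⁻¹ ≤ 1 := inv_le_one_of_one_le₀ (by nlinarith)
    rw [Real.norm_eq_abs, abs_mul]
    calc _ ≤ (B * 1) * (D * (1 + x ^ 2)⁻¹) :=
          mul_le_mul ((hB t ht x).1.trans (by gcongr)) (hD t ht x).1 (abs_nonneg _) (by linarith)
      _ = _ := by ring
  · exact ((hu.continuousOn_iteratedDeriv m x).mono hKT).mul
      ((hu.continuousOn_iteratedDeriv n x).mono hKT)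

lemma hasDerivAt_integral_mul (hu : IsSmoothSolution p γ T u) (n : ℕ)
    (hsymm : ∀ s ∈ Set.Ico 0 T, ∀ t ∈ Set.Ico 0 T,
      ∫ x, u s x * iteratedDeriv n (u t) x = ∫ x, u t x * iteratedDeriv n (u s) x)
    {s : ℝ} (hs : s ∈ Set.Ioo 0 T) :
    HasDerivAt (fun t => ∫ x, u t x * iteratedDeriv n (u t) x)
      (2 * ∫ x, deriv (fun τ => u τ x) s * iteratedDeriv n (u s) x) s := by
  obtain ⟨a, ha, has⟩ := exists_between hs.1
  obtain ⟨b, hsb, hb⟩ := exists_between hs.2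
  have hK : Set.Icc a b ⊆ Set.Ioo 0 T := fun t ht => ⟨ha.trans_le ht.1, ht.2.trans_lt hb⟩
  have hK' := hK.trans Set.Ioo_subset_Ico_self
  have hs' := Set.Ioo_subset_Ico_self hs
  obtain ⟨B, hB0, hB⟩ := hu.exists_bound 0 isCompact_Icc hK'
  obtain ⟨D, hD0, hD⟩ := hu.exists_bound n isCompact_Icc hK'
  have hsK : s ∈ Set.Icc a b := ⟨has.le, hsb.le⟩
  have hnhds : Set.Icc a b ∈ nhdsWithin s {s}ᶜ := nhdsWithin_le_nhds (Icc_mem_nhds has hsb)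
  have hint : ∀ t ∈ Set.Ico 0 T, ∀ t' ∈ Set.Ico 0 T,
      IntBdd fun x => u t x * iteratedDeriv n (u t') x := fun t ht t' ht' =>
    (hu.isSchwartzFn ht).intBdd.mul ((hu.isSchwartzFn ht').intBdd_iteratedDeriv n)
  rw [hasDerivAt_iff_tendsto_slope, ← integral_const_mul]
  have hslope : (fun t => ∫ x, slope (fun τ => u τ x) s t
      * (iteratedDeriv n (u t) x + iteratedDeriv n (u s) x)) =ᶠ[nhdsWithin s {s}ᶜ]
      slope (fun t => ∫ x, u t x * iteratedDeriv n (u t) x) s := by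
    filter_upwards [hnhds] with t ht
    have ht' := hK' ht
    have e : ∀ x, slope (fun τ => u τ x) s t
        * (iteratedDeriv n (u t) x + iteratedDeriv n (u s) x)
        = (t - s)⁻¹ * (((u t x * iteratedDeriv n (u t) x - u s x * iteratedDeriv n (u s) x)
          + (u t x * iteratedDeriv n (u s) x - u s x * iteratedDeriv n (u t) x))) := fun x => by
      rw [slope_def_field]; ring
    simp only [e]
    rw [integral_const_mul,
      integral_add ((hint t ht' t ht').sub (hint s hs' s hs')).integrable
        ((hint t ht' s hs').sub (hint s hs' t ht')).integrable,
      integral_sub (hint t ht' t ht').integrable (hint s hs' s hs').integrable,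
      integral_sub (hint t ht' s hs').integrable (hint s hs' t ht').integrable,
      hsymm t ht' s hs', slope_def_field]
    ring
  refine Filter.Tendsto.congr' hslope (tendsto_integral_filter_of_dominated_convergence
    (fun x => B * (2 * D) * (1 + x ^ 2)⁻¹) ?_ ?_ (integrable_inv_one_add_sq.const_mul _)
    (Filter.Eventually.of_forall fun x => ?_))
  · filter_upwards [hnhds] with t ht
    have h1 := hu.isSchwartzFn (hK' ht)
    have h2 := hu.isSchwartzFn hs'
    have c1 := h1.intBdd.continuous
    have c2 := h2.intBdd.continuous
    have c3 := (h1.intBdd_iteratedDeriv n).continuous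
    have c4 := (h2.intBdd_iteratedDeriv n).continuous
    simp only [slope_def_field]
    exact (by fun_prop : Continuous _).aestronglyMeasurable
  · filter_upwards [hnhds] with t ht
    refine Filter.Eventually.of_forall fun x => ?_
    have hx : (1 + x ^ 2)⁻¹ ≤ 1 := inv_le_one_of_one_le₀ (by nlinarith)
    have hx0 : 0 ≤ (1 + x ^ 2)⁻¹ := by positivity
    have hmv := (convex_Icc a b).norm_image_sub_le_of_norm_hasDerivWithin_le
      (f := fun τ => u τ x) (f' := fun τ => deriv (fun τ => u τ x) τ) (C := B * (1 + x ^ 2)⁻¹)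
      (fun τ hτ => (hu.hasDerivAt_time (hK hτ) x).hasDerivWithinAt)
      (fun τ hτ => by simpa using (hB τ hτ x).2) hsK ht
    have hsl : |slope (fun τ => u τ x) s t| ≤ B * (1 + x ^ 2)⁻¹ := by
      rw [slope_def_field, abs_div]
      exact div_le_of_le_mul₀ (abs_nonneg _) (by positivity) hmv
    have hw : |iteratedDeriv n (u t) x + iteratedDeriv n (u s) x| ≤ 2 * D := by
      refine (abs_add_le _ _).trans ?_
      have h1 := (hD t ht x).1
      have h2 := (hD s hsK x).1
      have h3 : D * (1 + x ^ 2)⁻¹ ≤ D := mul_le_of_le_one_right hD0 hx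
      linarith
    rw [Real.norm_eq_abs, abs_mul]
    calc _ ≤ (B * (1 + x ^ 2)⁻¹) * (2 * D) :=
          mul_le_mul hsl hw (abs_nonneg _) (by positivity)
      _ = _ := by ring
  · have h1 := hasDerivAt_iff_tendsto_slope.1 (hu.hasDerivAt_time hs x)
    have h2 : Filter.Tendsto (fun t => iteratedDeriv n (u t) x) (nhdsWithin s {s}ᶜ)
        (nhds (iteratedDeriv n (u s) x)) :=
      ((hu.continuousOn_iteratedDeriv n x).continuousAt
        (Ico_mem_nhds hs.1 hs.2)).tendsto.mono_left nhdsWithin_le_nhds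
    have h3 := h1.mul (h2.add_const (iteratedDeriv n (u s) x))
    convert h3 using 2
    ring

/-- The equation, tested against a Schwartz function. -/
lemma integral_deriv_time_mul (hu : IsSmoothSolution p γ T u) (hp : p ≠ 0) (hmeas : Measurable γ)
    (hpoly : PolyBounded γ) {t : ℝ} (ht : t ∈ Set.Ico 0 T) {w : ℝ → ℝ} (hw : IsSchwartzFn w) :
    ∫ x, deriv (fun τ => u τ x) t * w x
      = -((∫ x, iteratedDeriv 1 (u t) x * w x) + (∫ x, iteratedDeriv 3 (u t) x * w x)
        + (∫ x, u t x ^ p * iteratedDeriv 1 (u t) x * w x) + ∫ x, Ldamp γ (u t) x * w x) := by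
  have h := hu.isSchwartzFn ht
  have i1 := (h.intBdd_iteratedDeriv 1).mul hw.intBdd
  have i2 := (h.intBdd_iteratedDeriv 3).mul hw.intBdd
  have i3 := ((h.intBdd.pow hp).mul (h.intBdd_iteratedDeriv 1)).mul hw.intBdd
  have i4 := h.integrable_Ldamp_mul hw hmeas hpoly
  rw [← integral_add i1.integrable i2.integrable,
    ← integral_add (i1.add i2).integrable i3.integrable,
    ← integral_add ((i1.add i2).add i3).integrable i4, ← integral_neg]
  congr 1
  ext x
  have he := hu.2.2.2 t ht x
  rw [iteratedDeriv_one]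
  linear_combination w x * he

lemma integral_deriv_time_mul_self_nonpos (hu : IsSmoothSolution p γ T u) (hp : p ≠ 0)
    (hmeas : Measurable γ) (hpoly : PolyBounded γ) (hnn : ∀ ξ, 0 ≤ γ ξ) {t : ℝ}
    (ht : t ∈ Set.Ico 0 T) : ∫ x, deriv (fun τ => u τ x) t * u t x ≤ 0 := by
  have h := hu.isSchwartzFn ht
  rw [hu.integral_deriv_time_mul hp hmeas hpoly ht h]
  have e1 := h.integral_iteratedDeriv_mul_succ 0
  have e2 := h.integral_iteratedDeriv_mul_add_three 0
  simp only [iteratedDeriv_zero, zero_add, mul_comm (u t _)] at e1 e2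
  rw [e1, e2, h.integral_pow_mul_deriv_mul hp]
  linarith [h.integral_Ldamp_mul_self_nonneg hmeas hpoly hnn]

lemma integral_deriv_time_mul_iteratedDeriv_four_nonpos (hu : IsSmoothSolution p γ T u)
    (hp : 4 ≤ p) (hmeas : Measurable γ) (hpoly : PolyBounded γ) {m k : ℝ}
    (hθ : ∀ ξ, Omega p (√m) (√k) ≤ γ ξ) {t : ℝ} (ht : t ∈ Set.Ico 0 T)
    (hm : ∫ x, u t x ^ 2 ≤ m) (hk : ∫ x, iteratedDeriv 2 (u t) x ^ 2 ≤ 2 * k) :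
    ∫ x, deriv (fun τ => u τ x) t * iteratedDeriv 4 (u t) x ≤ 0 := by
  have h := hu.isSchwartzFn ht
  rw [hu.integral_deriv_time_mul (by lia) hmeas hpoly ht (h.iteratedDeriv 4),
    h.integral_iteratedDeriv_mul_add_three 1, h.integral_iteratedDeriv_mul_succ 3]
  linarith [h.neg_integral_nonlinear_le hp hm hk,
    h.mul_integral_le_integral_Ldamp_mul hmeas hpoly hθ]

lemma integral_mul_iteratedDeriv_four (hu : IsSmoothSolution p γ T u) {t : ℝ}
    (ht : t ∈ Set.Ico 0 T) :
    ∫ x, u t x * iteratedDeriv 4 (u t) x = ∫ x, iteratedDeriv 2 (u t) x ^ 2 := by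
  simp only [sq]
  exact (hu.isSchwartzFn ht).integral_mul_iteratedDeriv_four (hu.isSchwartzFn ht)

/-- The mass `‖u(t)‖²` is nonincreasing. -/
lemma integral_sq_le (hu : IsSmoothSolution p γ T u) (hp : p ≠ 0)
    (hmeas : Measurable γ) (hpoly : PolyBounded γ) (hnn : ∀ ξ, 0 ≤ γ ξ) {t : ℝ}
    (ht : t ∈ Set.Ico 0 T) : ∫ x, u t x ^ 2 ≤ ∫ x, u 0 x ^ 2 := by
  have hc := hu.continuousOn_integral_mul 0 0 ht.2
  have hd : ∀ s ∈ Set.Ioo 0 t, HasDerivAt (fun t => ∫ x, u t x * u t x)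
      (2 * ∫ x, deriv (fun τ => u τ x) s * u s x) s := fun s hs => by
    simpa using hu.hasDerivAt_integral_mul 0 (fun s _ t _ => by simp [mul_comm])
      ⟨hs.1, hs.2.trans ht.2⟩
  simp only [iteratedDeriv_zero] at hc
  have hanti : AntitoneOn (fun t => ∫ x, u t x * u t x) (Set.Icc 0 t) := by
    refine antitoneOn_of_deriv_nonpos (convex_Icc 0 t) hc ?_ ?_ <;> rw [interior_Icc]
    · exact fun s hs => (hd s hs).differentiableAt.differentiableWithinAt
    · intro s hs
      rw [(hd s hs).deriv]
      linarith [hu.integral_deriv_time_mul_self_nonpos hp hmeas hpoly hnn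
        ⟨hs.1.le, hs.2.trans ht.2⟩]
  simpa only [sq] using hanti (Set.left_mem_Icc.2 ht.1) (Set.right_mem_Icc.2 ht.1) ht.1

lemma integral_iteratedDeriv_two_sq_le (hu : IsSmoothSolution p γ T u) (hp : 4 ≤ p)
    (hmeas : Measurable γ) (hpoly : PolyBounded γ) (hnn : ∀ ξ, 0 ≤ γ ξ)
    (hθ : ∀ ξ, Omega p (√(∫ x, u 0 x ^ 2)) (√(∫ x, iteratedDeriv 2 (u 0) x ^ 2)) ≤ γ ξ)
    {t : ℝ} (ht : t ∈ Set.Ico 0 T) :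
    ∫ x, iteratedDeriv 2 (u t) x ^ 2 ≤ ∫ x, iteratedDeriv 2 (u 0) x ^ 2 := by
  have h0T : (0 : ℝ) ∈ Set.Ico 0 T := ⟨le_rfl, ht.1.trans_lt ht.2⟩
  have hmass : ∀ s ∈ Set.Ico 0 T, ∫ x, u s x ^ 2 ≤ ∫ x, u 0 x ^ 2 := fun s hs =>
    hu.integral_sq_le (by lia) hmeas hpoly hnn hs
  have hk0 : 0 ≤ ∫ x, iteratedDeriv 2 (u 0) x ^ 2 := integral_nonneg fun x => sq_nonneg _
  rcases hk0.eq_or_lt' with hk | hk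
  · have hu0 : ∀ x, u 0 x = 0 := fun x => by
      have := (hu.isSchwartzFn h0T).pow_eight_le x
      rw [hk, mul_zero] at this
      exact pow_eq_zero_iff (n := 8) (by norm_num) |>.1
        (le_antisymm this (Even.pow_nonneg (by decide) _))
    have hm := hmass t ht
    simp only [hu0, ne_eq, OfNat.ofNat_ne_zero, not_false_eq_true, zero_pow, integral_zero] at hm
    have hm' : ∫ x, u t x ^ 2 = 0 := le_antisymm hm (integral_nonneg fun x => sq_nonneg _)
    have hcs := sq_integral_mul_le (hu.isSchwartzFn ht).intBdd
      ((hu.isSchwartzFn ht).intBdd_iteratedDeriv 4)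
    rw [hm', zero_mul, hu.integral_mul_iteratedDeriv_four ht] at hcs
    rw [hk]
    nlinarith
  set h : ℝ → ℝ := fun s => ∫ x, iteratedDeriv 2 (u s) x ^ 2 with hh
  have hc : ContinuousOn h (Set.Icc 0 t) := by
    simpa only [hh, sq] using hu.continuousOn_integral_mul 2 2 ht.2
  have hd : ∀ s ∈ Set.Ioo 0 t, HasDerivAt h
      (2 * ∫ x, deriv (fun τ => u τ x) s * iteratedDeriv 4 (u s) x) s := fun s hs => by
    have hs' : s ∈ Set.Ioo 0 T := ⟨hs.1, hs.2.trans ht.2⟩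
    refine (hu.hasDerivAt_integral_mul 4 (fun s hs t ht => ?_) hs').congr_of_eventuallyEq ?_
    · rw [(hu.isSchwartzFn hs).integral_mul_iteratedDeriv_four (hu.isSchwartzFn ht),
        (hu.isSchwartzFn ht).integral_mul_iteratedDeriv_four (hu.isSchwartzFn hs)]
      simp only [mul_comm]
    · filter_upwards [Ico_mem_nhds hs'.1 hs'.2] with τ hτ
      exact (hu.integral_mul_iteratedDeriv_four hτ).symm
  have hclosed : IsClosed ({s | h s ≤ h 0} ∩ Set.Icc 0 t) := by
    rw [Set.inter_comm]
    exact hc.preimage_isClosed_of_isClosed isClosed_Icc isClosed_Iic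
  refine hclosed.Icc_subset_of_forall_exists_gt (a := 0) (Set.mem_ofPred.2 le_rfl) ?_
    (Set.right_mem_Icc.2 ht.1)
  rintro s ⟨hs, hst⟩ y hy
  have hev : ∀ᶠ τ in nhdsWithin s (Set.Ici s), h τ < 2 * h 0 :=
    ((hc s (Set.Ico_subset_Icc_self hst)).mono_of_mem_nhdsWithin
      (Icc_mem_nhdsGE_of_mem hst)).eventually
      (gt_mem_nhds (hs.trans_lt (by linarith [show 0 < h 0 from hk])))
  obtain ⟨r, hr, hrs⟩ := (mem_nhdsGE_iff_exists_Icc_subset).1 hev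
  set z := min (min r y) t with hz
  have hsz : s < z := lt_min (lt_min hr hy) hst.2
  have hzr : z ≤ r := (min_le_left _ _).trans (min_le_left _ _)
  have hzy : z ≤ y := (min_le_left _ _).trans (min_le_right _ _)
  have hzt : z ≤ t := min_le_right _ _
  have hanti : AntitoneOn h (Set.Icc s z) := by
    refine antitoneOn_of_deriv_nonpos (convex_Icc s z)
      (hc.mono (Set.Icc_subset_Icc hst.1 hzt)) ?_ ?_ <;> rw [interior_Icc]
    · exact fun τ hτ => (hd τ ⟨hst.1.trans_lt hτ.1, hτ.2.trans_le hzt⟩).differentiableAt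
        |>.differentiableWithinAt
    · intro τ hτ
      have hτT : τ ∈ Set.Ico 0 T := ⟨hst.1.trans hτ.1.le, (hτ.2.trans_le hzt).trans ht.2⟩
      rw [(hd τ ⟨hst.1.trans_lt hτ.1, hτ.2.trans_le hzt⟩).deriv]
      have hτ2 : h τ < 2 * h 0 := hrs ⟨hτ.1.le, hτ.2.le.trans hzr⟩
      linarith [hu.integral_deriv_time_mul_iteratedDeriv_four_nonpos hp hmeas hpoly hθ hτT
        (hmass τ hτT) hτ2.le]
  exact ⟨z, (hanti (Set.left_mem_Icc.2 hsz.le) (Set.right_mem_Icc.2 hsz.le) hsz.le).trans hs,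
    hsz, hzy⟩

end IsSmoothSolution

/-- For `p ≥ 4`: if the damping satisfies `γ(ξ) ≥ θ := Ω(‖u₀‖_{L²}, ‖∂ₓ²u₀‖_{L²})` for all
`ξ`, then along any smooth solution of the damped generalized KdV equation the `L²` norm of
`∂ₓ²u` never exceeds its initial value: the damping prevents blow-up. -/
theorem stmt_18 (p : ℕ) (hp : 4 ≤ p) (γ : ℝ → ℝ) (hmeas : Measurable γ)
    (hnn : ∀ ξ : ℝ, 0 ≤ γ ξ) (hpoly : PolyBounded γ) (T : ℝ) (hT : 0 < T)
    (u : ℝ → ℝ → ℝ) (hu : IsSmoothSolution p γ T u)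
    (hθ : ∀ ξ : ℝ,
      Omega p (Real.sqrt (∫ x : ℝ, (u 0 x) ^ 2))
          (Real.sqrt (∫ x : ℝ, (iteratedDeriv 2 (u 0) x) ^ 2)) ≤ γ ξ) :
    ∀ t ∈ Set.Ico (0 : ℝ) T,
      Real.sqrt (∫ x : ℝ, (iteratedDeriv 2 (u t) x) ^ 2) ≤
        Real.sqrt (∫ x : ℝ, (iteratedDeriv 2 (u 0) x) ^ 2) := by
  exact fun t ht => Real.sqrt_le_sqrt
    (hu.integral_iteratedDeriv_two_sq_le hp hmeas hpoly hnn hθ ht)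
end
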